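/- arXiv:2409.05844 — 3 statements merged into one kernel-verified Lean document; each statement's English description precedes it below -/
import Mathlib

section
/- Let P be a predicate on the positive integers such that both P and ¬P hold for infinitely many positive integers. If f_{¬P}(m+1) − f_{¬P}(m) ≥ m for all positive integers m, then for every positive integer n, f_P(n) = n + C_{¬P}(n + C_{¬P}(n)). -/
/-- `nthSat P n` is the `n`-th positive integer (indexed from `n = 1`) satisfying `P`. -/
noncomputable def nthSat (P : ℕ → Prop) (n : ℕ) : ℕ :=
  Nat.nth (fun m => 0 < m ∧ P m) (n - 1)

/-- `countSat P x` is the number of positive integers `m ≤ x` satisfying `P`. -/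
noncomputable def countSat (P : ℕ → Prop) (x : ℕ) : ℕ :=
  {m : ℕ | 0 < m ∧ m ≤ x ∧ P m}.ncard

theorem countSat_eq_count (P : ℕ → Prop) [DecidablePred (fun m => 0 < m ∧ P m)] (x : ℕ) :
    countSat P x = Nat.count (fun m => 0 < m ∧ P m) (x + 1) := by
  rw [Nat.count_eq_card_filter_range, countSat, ← Set.ncard_coe_finset]
  congr 1
  ext m
  simp only [Set.mem_ofPred_eq, Finset.coe_filter, Finset.mem_range]
  constructor
  · rintro ⟨a, b, c⟩
    exact ⟨by omega, a, c⟩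
  · rintro ⟨a, b, c⟩
    exact ⟨b, by omega, c⟩

theorem count_add_count_not (P : ℕ → Prop) [DecidablePred (fun m => 0 < m ∧ P m)]
    [DecidablePred (fun m => 0 < m ∧ ¬ P m)] (x : ℕ) :
    Nat.count (fun m => 0 < m ∧ P m) (x + 1) + Nat.count (fun m => 0 < m ∧ ¬ P m) (x + 1) = x := by
  induction x with
  | zero => simp [Nat.count_succ]
  | succ k ih =>
    rw [Nat.count_succ, Nat.count_succ _ (k + 1)]
    by_cases h : P (k + 1) <;> simp [h] <;> omega

theorem stmt_1 (P : ℕ → Prop)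
    (hP : {m : ℕ | 0 < m ∧ P m}.Infinite)
    (hP' : {m : ℕ | 0 < m ∧ ¬ P m}.Infinite)
    (hgap : ∀ m : ℕ, 0 < m →
      m ≤ nthSat (fun x => ¬ P x) (m + 1) - nthSat (fun x => ¬ P x) m)
    (n : ℕ) (hn : 0 < n) :
    nthSat P n =
      n + countSat (fun x => ¬ P x) (n + countSat (fun x => ¬ P x) n) := by
  classical
  obtain ⟨R, hR⟩ : ∃ R : ℕ → Prop, R = fun m => 0 < m ∧ ¬ P m := ⟨_, rfl⟩
  have hRi : ∀ m, 0 < m → ¬ P m → R m := by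
    intro m h1 h2
    rw [hR]
    exact ⟨h1, h2⟩
  have hRn : ∀ m, P m → ¬ R m := by
    intro m h1 h2
    rw [hR] at h2
    exact h2.2 h1
  have hRinf : (Set.ofPred R).Infinite := by
    rw [hR]
    exact hP'
  have hg : ∀ c : ℕ, c + 1 ≤ Nat.nth R (c + 1) - Nat.nth R c := by
    intro c
    rw [hR]
    exact hgap (c + 1) (by omega)
  have hcs : ∀ x, countSat (fun x => ¬ P x) x = Nat.count R (x + 1) := by
    intro x
    subst hR
    exact @countSat_eq_count (fun x => ¬ P x) (fun a => Classical.propDecidable _) x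
  have key : ∀ k : ℕ, P (n + k) → Nat.count R (n + k) = k →
      nthSat P n = n + k := by
    intro k h1 h2
    have h3 : Nat.count (fun m => 0 < m ∧ P m) (n + k - 1 + 1) + Nat.count R (n + k - 1 + 1)
        = n + k - 1 := by
      subst hR
      exact @count_add_count_not P _ (fun a => Classical.propDecidable _) (n + k - 1)
    rw [show n + k - 1 + 1 = n + k by omega, h2] at h3
    have h4 : Nat.nth (fun m => 0 < m ∧ P m) (Nat.count (fun m => 0 < m ∧ P m) (n + k)) = n + k :=
      Nat.nth_count (p := fun m => 0 < m ∧ P m) ⟨by omega, h1⟩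
    rw [show Nat.count (fun m => 0 < m ∧ P m) (n + k) = n - 1 by omega] at h4
    exact h4
  rw [hcs, hcs]
  obtain ⟨c, hc⟩ : ∃ c, c = Nat.count R (n + 1) := ⟨_, rfl⟩
  rw [← hc]
  have g := hg c
  have g1 : n + 1 ≤ Nat.nth R c := by
    rw [← Nat.count_le_iff_le_nth hRinf, ← hc]
  have g2 : Nat.count R (n + c + 2) ≤ c + 1 := by
    rw [Nat.count_le_iff_le_nth hRinf]; omega
  have m1 : c ≤ Nat.count R (n + c + 1) := hc ▸ Nat.count_monotone R (by omega)
  have m2 : Nat.count R (n + c + 1) ≤ c + 1 := (Nat.count_monotone R (by omega)).trans g2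
  rcases Nat.lt_or_ge c (Nat.count R (n + c + 1)) with h | h
  · have e : Nat.count R (n + c + 1) = c + 1 := by omega
    rw [e]
    refine key (c + 1) ?_ e
    by_contra hp
    have hr : R (n + c + 1) := hRi _ (by omega) hp
    rw [Nat.count_succ, if_pos hr] at g2
    omega
  · have e : Nat.count R (n + c + 1) = c := by omega
    rw [e]
    have hp : P (n + c) := by
      by_contra hp
      have hr : R (n + c) := hRi _ (by omega) hp
      rw [Nat.count_succ, if_pos hr] at e
      have : Nat.count R (n + 1) ≤ Nat.count R (n + c) := Nat.count_monotone R (by omega)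
      omega
    refine key c hp ?_
    have hr : ¬ R (n + c) := hRn _ hp
    rw [Nat.count_succ, if_neg hr] at e
    exact e
end

section
/- Let P be a predicate on the positive integers such that both P and ¬P hold for infinitely many positive integers, and suppose f_{¬P}(m+1) − f_{¬P}(m) ≥ m for all positive integers m. Let α be a real-valued increasing function on the positive integers with α(1) = 1 and f_{¬P}(m−1) ≤ α(m) ≤ f_{¬P}(m) for all m ≥ 2 and α(1) ≤ f_{¬P}(1), and define h(n) = max{m ∈ ℕ⁺ : α(m) ≤ n}. If moreover f_{¬P}(m) − α(m) < m for all positive integers m, then for every positive integer n: f_P(n) = n + h(n) + 1 if n + h(n) ≥ f_{¬P}(h(n) + 1), and f_P(n) = n + h(n) otherwise. -/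
theorem count_add_aux (P : ℕ → Prop) [DecidablePred (fun m => 0 < m ∧ P m)]
    [DecidablePred (fun m => 0 < m ∧ ¬ P m)] (N : ℕ) :
    Nat.count (fun m => 0 < m ∧ P m) (N + 1) + Nat.count (fun m => 0 < m ∧ ¬ P m) (N + 1) = N := by
  induction N with
  | zero => simp [Nat.count_succ]
  | succ k ih =>
    rw [Nat.count_succ, Nat.count_succ (fun m => 0 < m ∧ ¬ P m)]
    by_cases hp : P (k + 1) <;> simp [hp] <;> omega

theorem nthSat_aux (P : ℕ → Prop)
    (hP' : {m : ℕ | 0 < m ∧ ¬ P m}.Infinite) (n j : ℕ) (hn : 0 < n) (hj : 0 < j)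
    (h1 : nthSat (fun x => ¬ P x) j < n + j) (h2 : n + j < nthSat (fun x => ¬ P x) (j + 1)) :
    nthSat P n = n + j := by
  classical
  unfold nthSat at *
  beta_reduce at h1 h2
  rw [Nat.add_sub_cancel] at h2
  have hc1 := (Nat.count_le_iff_le_nth (p := fun m => 0 < m ∧ ¬ P m) hP' (a := n + j) (b := j)).2 h2.le
  have hc2 := (Nat.lt_nth_iff_count_lt (p := fun m => 0 < m ∧ ¬ P m) hP' (a := j - 1) (b := n + j))
  have hc3 : j - 1 < Nat.count (fun m => 0 < m ∧ ¬ P m) (n + j) := hc2.2 h1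
  have hc : Nat.count (fun m => 0 < m ∧ ¬ P m) (n + j) = j := by omega
  have hPN : P (n + j) := by
    by_contra hnp
    have := Nat.nth_count (p := fun m => 0 < m ∧ ¬ P m) (n := n + j) ⟨by omega, hnp⟩
    rw [hc] at this
    omega
  have ha := count_add_aux P (n + j - 1)
  rw [show n + j - 1 + 1 = n + j by omega, hc] at ha
  have := Nat.nth_count (p := fun m => 0 < m ∧ P m) (n := n + j) ⟨by omega, hPN⟩
  rwa [show Nat.count (fun m => 0 < m ∧ P m) (n + j) = n - 1 by omega] at this

theorem stmt_7 (P : ℕ → Prop)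
    (hP : {m : ℕ | 0 < m ∧ P m}.Infinite)
    (hP' : {m : ℕ | 0 < m ∧ ¬ P m}.Infinite)
    (hgap : ∀ m : ℕ, 0 < m →
      m ≤ nthSat (fun x => ¬ P x) (m + 1) - nthSat (fun x => ¬ P x) m)
    (α : ℕ → ℝ)
    (hincr : ∀ m₁ m₂ : ℕ, 0 < m₁ → m₁ < m₂ → α m₁ < α m₂)
    (hα1 : α 1 = 1)
    (hα1' : α 1 ≤ (nthSat (fun x => ¬ P x) 1 : ℝ))
    (hαlow : ∀ m : ℕ, 2 ≤ m → (nthSat (fun x => ¬ P x) (m - 1) : ℝ) ≤ α m)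
    (hαhigh : ∀ m : ℕ, 2 ≤ m → α m ≤ (nthSat (fun x => ¬ P x) m : ℝ))
    (h : ℕ → ℕ)
    (hh : ∀ x : ℕ, 0 < x →
      0 < h x ∧ α (h x) ≤ (x : ℝ) ∧ ∀ m : ℕ, 0 < m → α m ≤ (x : ℝ) → m ≤ h x)
    (hclose : ∀ m : ℕ, 0 < m → (nthSat (fun x => ¬ P x) m : ℝ) - α m < (m : ℝ))
    (n : ℕ) (hn : 0 < n) :
    (n + h n ≥ nthSat (fun x => ¬ P x) (h n + 1) → nthSat P n = n + h n + 1) ∧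
    (n + h n < nthSat (fun x => ¬ P x) (h n + 1) → nthSat P n = n + h n) := by
  obtain ⟨hk, hle, hmax⟩ := hh n hn
  have hlt : (n : ℝ) < α (h n + 1) := by
    by_contra hc
    have := hmax (h n + 1) (by omega) (not_lt.1 hc)
    omega
  have hg1 : n < nthSat (fun x => ¬ P x) (h n + 1) := by
    have := hlt.trans_le (hαhigh (h n + 1) (by omega))
    exact_mod_cast this
  have hg0 : nthSat (fun x => ¬ P x) (h n) < n + h n := by
    have := hclose (h n) hk
    have h3 : (nthSat (fun x => ¬ P x) (h n) : ℝ) < n + h n := by linarith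
    exact_mod_cast h3
  have hg2 := hgap (h n + 1) (by omega)
  constructor
  · intro hc
    exact nthSat_aux P hP' n (h n + 1) hn (by omega) (by omega) (by omega)
  · intro hc
    exact nthSat_aux P hP' n (h n) hn hk hg0 hc
end

section
/- Fix an integer k with 3 ≤ k ≤ 5 and let c = ⌊(6n/(k−2))^{1/3}⌋. For every positive integer n, the n-th positive integer that is not a k-gonal pyramidal number equals n + c − 1 if 6n ≤ c(c−1)(c(k−2) + k + 1), and equals n + c otherwise. -/
theorem count_aux (P : ℕ → ℕ) (h0 : P 0 = 0) (hP : StrictMono P) :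
    ∀ x j : ℕ, P j < x → x ≤ P (j + 1) →
      (open Classical in
        Nat.count (fun x => 0 < x ∧ ¬∃ m : ℕ, 0 < m ∧ x = P m) x) + j + 1 = x := by
  classical
  intro x
  induction x with
  | zero => intro j h; omega
  | succ x ih =>
    intro j h1 h2
    rw [Nat.count_succ]
    rcases Nat.lt_or_ge (P j) x with h | h
    · have := (ih j h (by omega))
      rw [if_pos]
      · omega
      · refine ⟨by omega, ?_⟩
        rintro ⟨m, hm, rfl⟩
        have a := hP.lt_iff_lt.1 h
        have b := hP.lt_iff_lt.1 (show P m < P (j + 1) by omega)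
        omega
    · have hx : x = P j := by omega
      rcases j with _ | j
      · have : x = 0 := by omega
        subst this
        simp
      · have := (ih j (by rw [hx]; exact hP (by omega)) (by omega))
        rw [if_neg]
        · omega
        · rintro ⟨_, h⟩
          exact h ⟨j + 1, by omega, hx⟩

theorem nth_aux (P : ℕ → ℕ) (h0 : P 0 = 0) (hP : StrictMono P) (n j : ℕ) (hn : 0 < n)
    (h1 : P j < n + j) (h2 : n + j < P (j + 1)) :
    Nat.nth (fun x => 0 < x ∧ ¬∃ m : ℕ, 0 < m ∧ x = P m) (n - 1) = n + j := by
  classical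
  have h := (count_aux P h0 hP (n + j) j h1 h2.le)
  have hp : (fun x => 0 < x ∧ ¬∃ m : ℕ, 0 < m ∧ x = P m) (n + j) := by
    refine ⟨by omega, ?_⟩
    rintro ⟨m, hm, e⟩
    rw [e] at h1 h2
    have a := hP.lt_iff_lt.1 h1
    have b := hP.lt_iff_lt.1 h2
    omega
  have e := Nat.nth_count (p := fun x => 0 < x ∧ ¬∃ m : ℕ, 0 < m ∧ x = P m) hp
  have h' : Nat.count (fun x => 0 < x ∧ ¬∃ m : ℕ, 0 < m ∧ x = P m) (n + j) = n - 1 := by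
    have : Nat.count (fun x => 0 < x ∧ ¬∃ m : ℕ, 0 < m ∧ x = P m) (n + j) + j + 1 = n + j := by
      convert h
    omega
  rw [h'] at e
  exact e

theorem main_aux (P : ℕ → ℕ) (d : ℕ) (hd1 : 1 ≤ d) (hd3 : d ≤ 3)
    (hP : ∀ m, 6 * P m + m * (m + 1) * d = m * (m + 1) * (m * d + 3))
    (n c : ℕ) (hn : 0 < n) (hc1 : c ^ 3 * d ≤ 6 * n) (hc2 : 6 * n < (c + 1) ^ 3 * d) :
    Nat.nth (fun x => 0 < x ∧ ¬∃ m : ℕ, 0 < m ∧ x = P m) (n - 1) =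
      if 6 * n ≤ c * (c - 1) * (c * d + (d + 2) + 1) then n + c - 1 else n + c := by
  have h0 : P 0 = 0 := by have := hP 0; simp at this; exact this
  have hm : StrictMono P := by
    apply strictMono_nat_of_lt_succ
    intro m
    have a := hP m
    have b := hP (m + 1)
    have : 6 * P (m + 1) = 6 * P m + (m + 1) * (3 * m * d + 6) := by
      zify at a b ⊢
      linear_combination b - a
    have : 0 < (m + 1) * (3 * m * d + 6) := by positivity
    omega
  rcases c with _ | c
  · exfalso; simp at hc2; omega
  have a := hP c
  have b := hP (c + 1)
  have e := hP (c + 1 + 1)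
  simp only [Nat.add_sub_cancel]
  have key : 6 * P (c + 1) = (c + 1) * c * ((c + 1) * d + (d + 2) + 1) + 6 * (c + 1) := by
    zify at b ⊢
    linear_combination b
  split_ifs with h
  · have : n + (c + 1) - 1 = n + c := by omega
    rw [this]
    apply nth_aux P h0 hm n c hn
    · zify at a hc1 ⊢
      have hc0 : (0 : ℤ) ≤ c := by positivity
      interval_cases d <;> push_cast at * <;> nlinarith [mul_nonneg hc0 hc0]
    · omega
  · apply nth_aux P h0 hm n (c + 1) hn
    · omega
    · zify at e hc2 ⊢
      have hc0 : (0 : ℤ) ≤ c := by positivity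
      interval_cases d <;> push_cast at * <;> nlinarith [mul_nonneg hc0 hc0]

theorem poly_aux (d : ℕ) (hd1 : 1 ≤ d) (hd3 : d ≤ 3) (m : ℕ) :
    6 * (m * (m + 1) * (m * d + 5 - (d + 2)) / 6) + m * (m + 1) * d
      = m * (m + 1) * (m * d + 3) := by
  have hdvd : 6 ∣ m * (m + 1) * (m * d + 5 - (d + 2)) := by
    have e : m * d + 5 - (d + 2) = m * d + (3 - d) := by omega
    rw [e, Nat.dvd_iff_mod_eq_zero]
    have : m % 6 < 6 := Nat.mod_lt _ (by norm_num)
    interval_cases d <;> interval_cases h : m % 6 <;> simp [Nat.add_mod, Nat.mul_mod, h]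
  rw [Nat.mul_div_cancel' hdvd, ← Nat.mul_add]
  congr 1
  omega

theorem stmt_15 (k : ℕ) (hk3 : 3 ≤ k) (hk5 : k ≤ 5) (n : ℕ) (hn : 0 < n)
    (c : ℕ) (hc : c = ⌊(6 * (n : ℝ) / ((k : ℝ) - 2)) ^ ((1 : ℝ) / 3)⌋₊) :
    Nat.nth (fun x => 0 < x ∧
        ¬∃ m : ℕ, 0 < m ∧ x = m * (m + 1) * (m * (k - 2) + 5 - k) / 6) (n - 1) =
      if 6 * n ≤ c * (c - 1) * (c * (k - 2) + k + 1) then n + c - 1 else n + c := by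
  obtain ⟨d, rfl⟩ : ∃ d, k = d + 2 := ⟨k - 2, by omega⟩
  simp only [Nat.add_sub_cancel]
  have hd : (0 : ℝ) < d := by exact_mod_cast (by omega : 0 < d)
  have hk : ((d + 2 : ℕ) : ℝ) - 2 = d := by push_cast; ring
  rw [hk] at hc
  have hx : 0 ≤ 6 * (n : ℝ) / d := by positivity
  have hy := Real.rpow_nonneg hx ((1 : ℝ) / 3)
  have h3 : ((6 * (n : ℝ) / d) ^ ((1 : ℝ) / 3)) ^ 3 = 6 * (n : ℝ) / d := by
    rw [← Real.rpow_natCast, ← Real.rpow_mul hx]; norm_num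
  have l := Nat.floor_le hy
  have u := Nat.lt_floor_add_one ((6 * (n : ℝ) / d) ^ ((1 : ℝ) / 3))
  rw [← hc] at l u
  have l3 := pow_le_pow_left₀ (by positivity) l 3
  have u3 := pow_lt_pow_left₀ u hy (by norm_num : 3 ≠ 0)
  rw [h3] at l3 u3
  rw [le_div_iff₀ hd] at l3
  rw [div_lt_iff₀ hd] at u3
  exact main_aux (fun m => m * (m + 1) * (m * d + 5 - (d + 2)) / 6) d (by omega) (by omega)
    (poly_aux d (by omega) (by omega)) n c hn (by exact_mod_cast l3) (by exact_mod_cast u3)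
end
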